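/- Let d ≥ 2 and let ρ be a Hermitian d×d complex matrix with tr(ρ) = 1. Let N be Hermitian with tr(N) = 0 and tr(N²) = d; let M be a real observable (Hermitian, Mᵀ = M) with tr(M) = 0 and tr(M²) = d; let M̂ be an imaginary observable (Hermitian, M̂ᵀ = −M̂) with tr(M̂²) = d. Then (d²−1) · ∫_{U(d)} (tr(U·ρ·Uᴴ·N))² dμ_U(U) = L · ∫_{O(d)} (tr(O·ρ·Oᵀ·M))² dμ_O(O) + L̂ · ∫_{O(d)} (tr(O·ρ·Oᵀ·M̂))² dμ_O(O), where L = (d−1)(d+2)/2 and L̂ = d(d−1)/2. -/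

import Mathlib

open MeasureTheory Matrix

/-- Entrywise coercion of a real orthogonal matrix to a complex matrix. -/
def OC {d : ℕ} (O : Matrix.orthogonalGroup (Fin d) ℝ) : Matrix (Fin d) (Fin d) ℂ :=
  (O : Matrix (Fin d) (Fin d) ℝ).map Complex.ofReal

theorem isotropic_signedPerm {n : Type*} [Fintype n] [DecidableEq n] {T : n → n → n → n → ℂ}
    (hT : ∀ O ∈ orthogonalGroup n ℝ, ∀ i j k l, T i j k l =
      ∑ a, ∑ b, ∑ c, ∑ e, (O a i * O b j * O c k * O e l : ℝ) * T a b c e)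
    (σ : Equiv.Perm n) (ε : n → ℝ) (hε : ∀ i, ε i * ε i = 1) (i j k l : n) :
    T i j k l = (ε i * ε j * ε k * ε l : ℝ) * T (σ i) (σ j) (σ k) (σ l) := by
  have h := hT (.of fun a i => if a = σ i then ε i else 0) (by
    rw [mem_orthogonalGroup_iff']
    ext p q
    by_cases h1 : p = q
    · subst h1
      simp [mul_apply, hε]
    · simp [mul_apply, h1, Ne.symm h1]) i j k l
  rw [h]
  simp only [of_apply, Complex.ofReal_mul, apply_ite Complex.ofReal, Complex.ofReal_zero]
  simp [mul_assoc, ite_mul]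

theorem isotropic_diag {n : Type*} [Fintype n] [DecidableEq n] {T : n → n → n → n → ℂ}
    (hT : ∀ O ∈ orthogonalGroup n ℝ, ∀ i j k l, T i j k l =
      ∑ a, ∑ b, ∑ c, ∑ e, (O a i * O b j * O c k * O e l : ℝ) * T a b c e)
    (h0 : ∀ i j k l, ¬ (i = j ∧ k = l) → ¬ (i = k ∧ j = l) → ¬ (i = l ∧ j = k) → T i j k l = 0)
    {p q : n} (hpq : p ≠ q) (α β b c : ℂ)
    (hp : T p p p p = α) (hq : T q q q q = α) (hβ : T p p q q = β) (hβ' : T q q p p = β)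
    (hb : T p q p q = b) (hb' : T q p q p = b) (hc : T p q q p = c) (hc' : T q p p q = c) :
    α = β + b + c := by
  set v : n → ℝ := Pi.single p 1 - Pi.single q 2 with hv
  have hvv : v ⬝ᵥ v = 5 := by
    simp [hv, hpq, hpq.symm]; norm_num
  have h := hT (1 - (2 / 5 : ℝ) • vecMulVec v v) (by
    rw [mem_orthogonalGroup_iff']
    have h1 : (1 - (2 / 5 : ℝ) • vecMulVec v v)ᵀ = 1 - (2 / 5 : ℝ) • vecMulVec v v := by
      simp [transpose_vecMulVec]
    have h2 : vecMulVec v v * vecMulVec v v = (5 : ℝ) • vecMulVec v v := by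
      rw [vecMulVec_mul_vecMulVec, hvv]
      ext; simp [vecMulVec_apply]; ring
    rw [h1, sub_mul, mul_sub, mul_sub]
    simp only [smul_mul_smul_comm, h2, one_mul, mul_one]
    ext; simp; ring) p p p p
  have hcol : ∀ a, (1 - (2 / 5 : ℝ) • vecMulVec v v) a p =
      (if a = p then 3 / 5 else 0) + (if a = q then 4 / 5 else 0) := by
    intro a
    by_cases ha : a = p
    · subst ha; simp [hv, vecMulVec_apply, hpq]; norm_num
    · by_cases hb : a = q
      · subst hb; simp [hv, vecMulVec_apply, hpq, ha]; norm_num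
      · simp [hv, vecMulVec_apply, ha, hb]
  have hsum (f : n → ℂ) : ∑ a, ((1 - (2 / 5 : ℝ) • vecMulVec v v) a p : ℂ) * f a =
      3 / 5 * f p + 4 / 5 * f q := by
    simp [hcol, apply_ite Complex.ofReal, add_mul, Finset.sum_add_distrib]
  simp only [Complex.ofReal_mul, mul_assoc, ← Finset.mul_sum, hsum] at h
  rw [h0 p p p q, h0 p p q p, h0 p q p p, h0 q p p p, h0 q q q p, h0 q q p q, h0 q p q q,
    h0 p q q q, hp, hq, hβ, hβ', hb, hb', hc, hc'] at h
  · linear_combination (625 / 288) * h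
  all_goals simp [hpq, hpq.symm]

/-- A rank-four tensor invariant under the real orthogonal group is a combination of the three
pairings of Kronecker deltas. -/
theorem exists_eq_delta_of_isotropic {n : Type*} [Fintype n] [DecidableEq n] [Nontrivial n]
    {T : n → n → n → n → ℂ}
    (hT : ∀ O ∈ orthogonalGroup n ℝ, ∀ i j k l, T i j k l =
      ∑ a, ∑ b, ∑ c, ∑ e, (O a i * O b j * O c k * O e l : ℝ) * T a b c e) :
    ∃ β b c : ℂ, ∀ i j k l, T i j k l =
      β * ((1 : Matrix n n ℂ) i j * (1 : Matrix n n ℂ) k l) +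
      b * ((1 : Matrix n n ℂ) i k * (1 : Matrix n n ℂ) j l) +
      c * ((1 : Matrix n n ℂ) i l * (1 : Matrix n n ℂ) j k) := by
  have h0 : ∀ i j k l, ¬ (i = j ∧ k = l) → ¬ (i = k ∧ j = l) → ¬ (i = l ∧ j = k) →
      T i j k l = 0 := by
    intro i j k l h1 h2 h3
    have key : ∀ m : n, ((if i = m then -1 else 1) * (if j = m then -1 else 1) *
        (if k = m then -1 else 1) * (if l = m then -1 else 1) : ℝ) = -1 → T i j k l = 0 := by
      intro m hm
      have := isotropic_signedPerm hT 1 (fun x => if x = m then -1 else 1)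
        (fun x => by split_ifs <;> norm_num) i j k l
      simp only [hm, Equiv.Perm.coe_one, id] at this
      push_cast at this
      linear_combination this / 2
    by_cases hi : i = j
    · subst hi
      by_cases hl : l = i
      · subst hl
        exact key k (by grind)
      · exact key l (by grind)
    · by_cases hki : k = i
      · subst hki
        by_cases hl : l = k
        · exact key j (by grind)
        · exact key j (by grind)
      · by_cases hl : l = i
        · subst hl
          exact key j (by grind)
        · exact key i (by grind)
  obtain ⟨p, q, hpq⟩ := exists_pair_ne n
  have hperm (σ : Equiv.Perm n) (i j k l : n) : T (σ i) (σ j) (σ k) (σ l) = T i j k l := by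
    have := isotropic_signedPerm hT σ (fun _ => 1) (by simp) i j k l
    simpa using this.symm
  have htrans (i j : n) (hij : i ≠ j) : ∃ σ : Equiv.Perm n, σ p = i ∧ σ q = j :=
    (MulAction.is_two_pretransitive_iff.mp
      (Equiv.Perm.isMultiplyPretransitive n 2)) hpq hij
  have hα (i : n) : T i i i i = T p p p p := by
    simpa using hperm (Equiv.swap p i) p p p p
  have hβ (i j : n) (hij : i ≠ j) : T i i j j = T p p q q := by
    obtain ⟨σ, rfl, rfl⟩ := htrans i j hij
    exact hperm σ _ _ _ _
  have hb (i j : n) (hij : i ≠ j) : T i j i j = T p q p q := by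
    obtain ⟨σ, rfl, rfl⟩ := htrans i j hij
    exact hperm σ _ _ _ _
  have hc (i j : n) (hij : i ≠ j) : T i j j i = T p q q p := by
    obtain ⟨σ, rfl, rfl⟩ := htrans i j hij
    exact hperm σ _ _ _ _
  have hrel := isotropic_diag hT h0 hpq _ _ _ _ rfl (hα q) rfl (hβ q p hpq.symm) rfl
    (hb q p hpq.symm) rfl (hc q p hpq.symm)
  refine ⟨T p p q q, T p q p q, T p q q p, fun i j k l => ?_⟩
  · simp only [one_apply]
    by_cases hij : i = j
    · subst hij
      by_cases hkl : k = l
      · subst hkl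
        by_cases hik : i = k
        · subst hik
          rw [hα, hrel]; simp
        · simp [hik, hβ i k hik]
      · rw [h0 i i k l (by grind) (by grind) (by grind)]; grind
    · by_cases hik : i = k
      · subst hik
        by_cases hjl : j = l
        · subst hjl
          simp [hij, hb i j hij]
        · rw [h0 i j i l (by grind) (by grind) (by grind)]; grind
      · by_cases hil : i = l
        · subst hil
          by_cases hjk : j = k
          · subst hjk
            simp [hij, hc i j hij]
          · rw [h0 i j k i (by grind) (by grind) (by grind)]; grind
        · rw [h0 i j k l (by grind) (by grind) (by grind)]; grind

instance Matrix.unitaryGroup.instCompactSpace {n 𝕜 : Type*} [Fintype n] [DecidableEq n]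
    [RCLike 𝕜] : CompactSpace (unitaryGroup n 𝕜) := by
  refine (isCompact_iff_compactSpace (s := (unitaryGroup n 𝕜 : Set (Matrix n n 𝕜)))).mp ?_
  refine IsCompact.of_isClosed_subset
    (s := Set.univ.pi fun _ : n => Set.univ.pi fun _ : n => Metric.closedBall (0 : 𝕜) 1)
    (isCompact_univ_pi fun _ => isCompact_univ_pi fun _ => isCompact_closedBall _ _) ?_ ?_
  · have : (unitaryGroup n 𝕜 : Set (Matrix n n 𝕜)) = {A | A * star A = 1} := by
      ext A
      exact mem_unitaryGroup_iff
    rw [this]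
    exact isClosed_eq (by fun_prop) continuous_const
  · intro A hA i _ j _
    simpa using entry_norm_bound_of_unitary hA i j

instance MeasureTheory.Measure.IsHaarMeasure.instIsMulRightInvariantOfIsProbabilityMeasure
    {G : Type*} [Group G] [TopologicalSpace G] [IsTopologicalGroup G] [CompactSpace G]
    [MeasurableSpace G] [BorelSpace G] (μ : Measure G) [μ.IsHaarMeasure] [IsProbabilityMeasure μ] :
    μ.IsMulRightInvariant where
  map_mul_right_eq_self g := by
    have : IsProbabilityMeasure (μ.map (· * g)) :=
      Measure.isProbabilityMeasure_map (by fun_prop)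
    exact Measure.isHaarMeasure_eq_of_isProbabilityMeasure _ _

/-- The second moment of a random traceless matrix with `tr (W * W) = card n` whose law is invariant
under orthogonal conjugation is determined by three coefficients with two linear relations. -/
theorem exists_secondMoment_eq {n G : Type*} [Fintype n] [DecidableEq n] [Nontrivial n]
    [TopologicalSpace G] [CompactSpace G] [MeasurableSpace G] [BorelSpace G] (μ : Measure G)
    [IsProbabilityMeasure μ] {W : G → Matrix n n ℂ} (hW : Continuous W)
    (hinv : ∀ O ∈ orthogonalGroup n ℝ, ∀ i j k l,
      ∫ g, W g i j * W g k l ∂μ =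
        ∫ g, ((O.map Complex.ofReal)ᵀ * W g * O.map Complex.ofReal) i j *
          ((O.map Complex.ofReal)ᵀ * W g * O.map Complex.ofReal) k l ∂μ)
    (htr : ∀ g, (W g).trace = 0) (htr2 : ∀ g, (W g * W g).trace = Fintype.card n) :
    ∃ β b c : ℂ,
      (∀ i j k l, ∫ g, W g i j * W g k l ∂μ =
        β * ((1 : Matrix n n ℂ) i j * (1 : Matrix n n ℂ) k l) +
        b * ((1 : Matrix n n ℂ) i k * (1 : Matrix n n ℂ) j l) +
        c * ((1 : Matrix n n ℂ) i l * (1 : Matrix n n ℂ) j k)) ∧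
      Fintype.card n * β + b + c = 0 ∧ β + b + Fintype.card n * c = 1 ∧
      ∀ ρ : Matrix n n ℂ, ∫ g, (ρ * W g).trace ^ 2 ∂μ =
        β * ρ.trace ^ 2 + b * (ρ * ρᵀ).trace + c * (ρ * ρ).trace := by
  have hint (i j k l : n) (z : ℂ) : Integrable (fun g => z * (W g i j * W g k l)) μ := by
    refine Continuous.integrable_of_hasCompactSupport ?_ (HasCompactSupport.of_compactSpace _)
    have h (i j) : Continuous fun g => W g i j := hW.matrix_elem i j
    exact continuous_const.mul ((h i j).mul (h k l))
  have hint' (i j k l : n) : Integrable (fun g => W g i j * W g k l) μ := by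
    simpa using hint i j k l 1
  have hlin (z : n → n → n → n → ℂ) :
      ∫ g, ∑ i, ∑ j, ∑ k, ∑ l, z i j k l * (W g i j * W g k l) ∂μ =
        ∑ i, ∑ j, ∑ k, ∑ l, z i j k l * ∫ g, W g i j * W g k l ∂μ := by
    rw [integral_finsetSum _ fun i _ => integrable_finsetSum _ fun j _ =>
      integrable_finsetSum _ fun k _ => integrable_finsetSum _ fun l _ => hint i j k l _]
    refine Finset.sum_congr rfl fun i _ => ?_
    rw [integral_finsetSum _ fun j _ =>
      integrable_finsetSum _ fun k _ => integrable_finsetSum _ fun l _ => hint i j k l _]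
    refine Finset.sum_congr rfl fun j _ => ?_
    rw [integral_finsetSum _ fun k _ => integrable_finsetSum _ fun l _ => hint i j k l _]
    refine Finset.sum_congr rfl fun k _ => ?_
    rw [integral_finsetSum _ fun l _ => hint i j k l _]
    exact Finset.sum_congr rfl fun l _ => integral_const_mul _ _
  obtain ⟨β, b, c, hT⟩ := exists_eq_delta_of_isotropic
    (T := fun i j k l => ∫ g, W g i j * W g k l ∂μ) (by
      intro O hO i j k l
      rw [hinv O hO i j k l]
      have (g : G) : ((O.map Complex.ofReal)ᵀ * W g * O.map Complex.ofReal) i j *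
          ((O.map Complex.ofReal)ᵀ * W g * O.map Complex.ofReal) k l =
          ∑ a, ∑ b, ∑ c, ∑ e, (O a i * O b j * O c k * O e l : ℝ) * (W g a b * W g c e) := by
        have hexp (i j : n) : ((O.map Complex.ofReal)ᵀ * W g * O.map Complex.ofReal) i j =
            ∑ a, ∑ b, (O a i : ℂ) * O b j * W g a b := by
          simp only [mul_apply, transpose_apply, map_apply, Finset.sum_mul]
          rw [Finset.sum_comm]
          exact Finset.sum_congr rfl fun a _ => Finset.sum_congr rfl fun b _ => by ring
        rw [hexp, hexp]
        simp only [Finset.sum_mul]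
        simp only [Finset.mul_sum]
        refine Finset.sum_congr rfl fun a _ => Finset.sum_congr rfl fun b _ =>
          Finset.sum_congr rfl fun c _ => Finset.sum_congr rfl fun e _ => ?_
        push_cast
        ring
      simp only [this]
      exact hlin _)
  refine ⟨β, b, c, hT, ?_, ?_, ?_⟩
  · obtain ⟨p⟩ := (inferInstance : Nonempty n)
    have h : ∑ i, ∫ g, W g i i * W g p p ∂μ = 0 := by
      rw [← integral_finsetSum _ fun i _ => hint' i i p p]
      have (g : G) : ∑ i, W g i i * W g p p = 0 := by
        rw [← Finset.sum_mul]
        exact mul_eq_zero_of_left (htr g) _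
      simp [this]
    simp only [hT] at h
    simpa [Finset.sum_add_distrib, ← Finset.mul_sum, one_apply] using h
  · have h : ∑ i, ∑ j, ∫ g, W g i j * W g j i ∂μ = Fintype.card n := by
      simp_rw [← integral_finsetSum _ fun j _ => hint' _ j j _]
      rw [← integral_finsetSum _ fun i _ => integrable_finsetSum _ fun j _ => hint' i j j i]
      have (g : G) : ∑ i, ∑ j, W g i j * W g j i = Fintype.card n := by
        simpa [trace, mul_apply] using htr2 g
      simp [this]
    simp only [hT] at h
    have hn : (Fintype.card n : ℂ) ≠ 0 := by simp
    have : (Fintype.card n : ℂ) * (β + b + Fintype.card n * c) = Fintype.card n * 1 := by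
      rw [mul_one]
      conv_rhs => rw [← h]
      simp [Finset.sum_add_distrib, one_apply]
      ring
    exact mul_left_cancel₀ hn this
  · intro ρ
    have (g : G) : (ρ * W g).trace ^ 2 =
        ∑ i, ∑ j, ∑ k, ∑ l, (ρ j i * ρ l k) * (W g i j * W g k l) := by
      rw [trace_mul_comm, sq]
      simp only [trace, diag_apply, mul_apply]
      simp only [Finset.sum_mul]
      simp only [Finset.mul_sum]
      refine Finset.sum_congr rfl fun i _ => Finset.sum_congr rfl fun j _ =>
        Finset.sum_congr rfl fun k _ => Finset.sum_congr rfl fun l _ => ?_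
      ring
    simp only [this]
    rw [hlin]
    have h1 : ρ.trace ^ 2 = ∑ i, ∑ k, ρ i i * ρ k k := by
      rw [sq, trace, Finset.sum_mul_sum]
      rfl
    simp only [hT, mul_add, Finset.sum_add_distrib]
    congr 1
    · congr 1
      · simp [one_apply, h1, Finset.mul_sum]
        exact Finset.sum_congr rfl fun _ _ => Finset.sum_congr rfl fun _ _ => by ring
      · simp [one_apply, trace, mul_apply, Finset.mul_sum]
        rw [Finset.sum_comm]
        exact Finset.sum_congr rfl fun _ _ => Finset.sum_congr rfl fun _ _ => by ring
    · simp [one_apply, trace, mul_apply, Finset.mul_sum]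
      exact Finset.sum_congr rfl fun _ _ => Finset.sum_congr rfl fun _ _ => by ring

theorem OC_transpose_mul_self {d : ℕ} (O : orthogonalGroup (Fin d) ℝ) : (OC O)ᵀ * OC O = 1 := by
  have h : (O : Matrix (Fin d) (Fin d) ℝ)ᵀ * O = 1 :=
    (mem_orthogonalGroup_iff' (Fin d) ℝ).mp O.2
  have h' := congrArg (Complex.ofRealHom.mapMatrix) h
  rw [map_mul, map_one] at h'
  exact h'

theorem OC_mul_transpose_self {d : ℕ} (O : orthogonalGroup (Fin d) ℝ) : OC O * (OC O)ᵀ = 1 :=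
  mul_eq_one_comm.mp (OC_transpose_mul_self O)

theorem OC_mul {d : ℕ} (O P : orthogonalGroup (Fin d) ℝ) : OC (O * P) = OC O * OC P := by
  exact map_mul (Complex.ofRealHom.mapMatrix) (O : Matrix (Fin d) (Fin d) ℝ) P

theorem continuous_OC {d : ℕ} : Continuous (OC (d := d)) :=
  continuous_subtype_val.matrix_map Complex.continuous_ofReal

/-- The real orthogonal matrix `O`, viewed as a complex unitary matrix. -/
def OCUnitary {d : ℕ} (O : orthogonalGroup (Fin d) ℝ) : unitaryGroup (Fin d) ℂ :=
  ⟨OC O, by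
    rw [mem_unitaryGroup_iff']
    have : star (OC O) = (OC O)ᵀ := by
      ext i j
      simp [OC, star_apply]
    rw [this, OC_transpose_mul_self]⟩

theorem orthogonal_secondMoment {d : ℕ} (hd : 2 ≤ d)
    [MeasurableSpace (orthogonalGroup (Fin d) ℝ)] [BorelSpace (orthogonalGroup (Fin d) ℝ)]
    (μ : Measure (orthogonalGroup (Fin d) ℝ)) [μ.IsHaarMeasure] [IsProbabilityMeasure μ]
    {M : Matrix (Fin d) (Fin d) ℂ} (hM : M.trace = 0) (hM2 : (M * M).trace = d)
    {s : ℂ} (hs : Mᵀ = s • M) :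
    ∃ β b c : ℂ, b = s * c ∧ d * β + b + c = 0 ∧ β + b + d * c = 1 ∧
      ∀ ρ : Matrix (Fin d) (Fin d) ℂ, ∫ O, (OC O * ρ * (OC O)ᵀ * M).trace ^ 2 ∂μ =
        β * ρ.trace ^ 2 + b * (ρ * ρᵀ).trace + c * (ρ * ρ).trace := by
  have : Nontrivial (Fin d) := Fin.nontrivial_iff_two_le.mpr hd
  obtain ⟨β, b, c, hT, h1, h2, h3⟩ := exists_secondMoment_eq μ
    (W := fun O => (OC O)ᵀ * M * OC O)
    ((continuous_OC.matrix_transpose.mul continuous_const).mul continuous_OC)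
    (fun P hP i j k l => by
      rw [← integral_mul_right_eq_self _ (⟨P, hP⟩ : orthogonalGroup (Fin d) ℝ)]
      have (O : orthogonalGroup (Fin d) ℝ) :
          (OC (O * ⟨P, hP⟩))ᵀ * M * OC (O * ⟨P, hP⟩) =
            (P.map Complex.ofReal)ᵀ * ((OC O)ᵀ * M * OC O) * P.map Complex.ofReal := by
        rw [OC_mul, transpose_mul]
        simp only [Matrix.mul_assoc]
        rfl
      simp only [this])
    (fun O => by rw [trace_mul_cycle, OC_mul_transpose_self, Matrix.one_mul, hM])
    (fun O => by
      have : (OC O)ᵀ * M * OC O * ((OC O)ᵀ * M * OC O) =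
          (OC O)ᵀ * M * (OC O * (OC O)ᵀ) * (M * OC O) := by
        simp only [Matrix.mul_assoc]
      rw [this, OC_mul_transpose_self, Matrix.mul_one, ← Matrix.mul_assoc,
        Matrix.mul_assoc _ M M, trace_mul_cycle, OC_mul_transpose_self, Matrix.one_mul, hM2]
      simp)
  simp only [Fintype.card_fin] at h1 h2
  refine ⟨β, b, c, ?_, h1, h2, fun ρ => ?_⟩
  · obtain ⟨p, q, hpq⟩ := exists_pair_ne (Fin d)
    have hb := hT p q p q
    have hc := hT p q q p
    have hW (O : orthogonalGroup (Fin d) ℝ) :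
        ((OC O)ᵀ * M * OC O) p q = s * ((OC O)ᵀ * M * OC O) q p := by
      have : ((OC O)ᵀ * M * OC O)ᵀ = s • ((OC O)ᵀ * M * OC O) := by
        simp only [transpose_mul, transpose_transpose, hs, Matrix.mul_assoc, Matrix.mul_smul,
          Matrix.smul_mul]
      simpa using congrFun₂ this q p
    have hbc : ∫ O, ((OC O)ᵀ * M * OC O) p q * ((OC O)ᵀ * M * OC O) p q ∂μ =
        s * ∫ O, ((OC O)ᵀ * M * OC O) p q * ((OC O)ᵀ * M * OC O) q p ∂μ := by
      rw [← integral_const_mul]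
      congr 1
      ext O
      nth_rewrite 2 [hW O]
      ring
    rw [hb, hc] at hbc
    simpa [one_apply, hpq, hpq.symm] using hbc
  · rw [← h3]
    congr 1
    ext O
    rw [Matrix.mul_assoc, Matrix.mul_assoc, trace_mul_comm, Matrix.mul_assoc]

theorem unitary_secondMoment {d : ℕ} (hd : 2 ≤ d)
    [MeasurableSpace (unitaryGroup (Fin d) ℂ)] [BorelSpace (unitaryGroup (Fin d) ℂ)]
    (μ : Measure (unitaryGroup (Fin d) ℂ)) [μ.IsHaarMeasure] [IsProbabilityMeasure μ]
    {N : Matrix (Fin d) (Fin d) ℂ} (hN : N.trace = 0) (hN2 : (N * N).trace = d) :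
    ∃ β c : ℂ, d * β + c = 0 ∧ β + d * c = 1 ∧
      ∀ ρ : Matrix (Fin d) (Fin d) ℂ,
        ∫ U, ((U : Matrix (Fin d) (Fin d) ℂ) * ρ * (U : Matrix (Fin d) (Fin d) ℂ)ᴴ * N).trace ^ 2
          ∂μ = β * ρ.trace ^ 2 + c * (ρ * ρ).trace := by
  have : Nontrivial (Fin d) := Fin.nontrivial_iff_two_le.mpr hd
  have hmul (U V : unitaryGroup (Fin d) ℂ) :
      ((U * V : unitaryGroup (Fin d) ℂ) : Matrix (Fin d) (Fin d) ℂ)ᴴ * N *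
        (U * V : unitaryGroup (Fin d) ℂ) =
      (V : Matrix (Fin d) (Fin d) ℂ)ᴴ * ((U : Matrix (Fin d) (Fin d) ℂ)ᴴ * N * U) * V := by
    rw [Submonoid.coe_mul, conjTranspose_mul]
    simp only [Matrix.mul_assoc]
  have hU (U : unitaryGroup (Fin d) ℂ) :
      (U : Matrix (Fin d) (Fin d) ℂ) * (U : Matrix (Fin d) (Fin d) ℂ)ᴴ = 1 :=
    mem_unitaryGroup_iff.mp U.2
  obtain ⟨β, b, c, hT, h1, h2, h3⟩ := exists_secondMoment_eq μ
    (W := fun U => (U : Matrix (Fin d) (Fin d) ℂ)ᴴ * N * (U : Matrix (Fin d) (Fin d) ℂ))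
    ((continuous_subtype_val.matrix_conjTranspose.mul continuous_const).mul
      continuous_subtype_val)
    (fun P hP i j k l => by
      rw [← integral_mul_right_eq_self _ (OCUnitary ⟨P, hP⟩)]
      have hP' : ((OCUnitary ⟨P, hP⟩ : unitaryGroup (Fin d) ℂ) : Matrix (Fin d) (Fin d) ℂ) =
        P.map Complex.ofReal := rfl
      have hP'' : (P.map Complex.ofReal)ᴴ = (P.map Complex.ofReal)ᵀ := by
        ext i j
        simp
      simp only [hmul, hP', hP''])
    (fun U => by rw [trace_mul_cycle, hU, Matrix.one_mul, hN])
    (fun U => by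
      have : (U : Matrix (Fin d) (Fin d) ℂ)ᴴ * N * (U : Matrix (Fin d) (Fin d) ℂ) *
          ((U : Matrix (Fin d) (Fin d) ℂ)ᴴ * N * (U : Matrix (Fin d) (Fin d) ℂ)) =
          (U : Matrix (Fin d) (Fin d) ℂ)ᴴ * N *
            ((U : Matrix (Fin d) (Fin d) ℂ) * (U : Matrix (Fin d) (Fin d) ℂ)ᴴ) *
            (N * (U : Matrix (Fin d) (Fin d) ℂ)) := by
        simp only [Matrix.mul_assoc]
      rw [this, hU, Matrix.mul_one, ← Matrix.mul_assoc,
        Matrix.mul_assoc _ N N, trace_mul_cycle, hU, Matrix.one_mul, hN2]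
      simp)
  simp only [Fintype.card_fin] at h1 h2
  obtain rfl : b = 0 := by
    obtain ⟨p, q, hpq⟩ := exists_pair_ne (Fin d)
    have hb := hT p q p q
    let D : Matrix (Fin d) (Fin d) ℂ := diagonal fun x => if x = p then Complex.I else 1
    have hD : D ∈ unitaryGroup (Fin d) ℂ := by
      rw [mem_unitaryGroup_iff, star_eq_conjTranspose, diagonal_conjTranspose,
        diagonal_mul_diagonal, ← diagonal_one]
      congr 1
      ext x
      by_cases hx : x = p <;> simp [hx]
    have hinv := integral_mul_right_eq_self (μ := μ) (fun U : unitaryGroup (Fin d) ℂ =>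
      ((U : Matrix (Fin d) (Fin d) ℂ)ᴴ * N * U) p q *
        ((U : Matrix (Fin d) (Fin d) ℂ)ᴴ * N * U) p q) ⟨D, hD⟩
    have hpt (A : Matrix (Fin d) (Fin d) ℂ) :
        (Dᴴ * A * D) p q * (Dᴴ * A * D) p q = -(A p q * A p q) := by
      simp only [D, diagonal_conjTranspose, mul_diagonal, diagonal_mul]
      simp only [Pi.star_apply, if_true, if_neg hpq.symm, mul_one]
      simp only [Complex.star_def, Complex.conj_I]
      linear_combination (A p q * A p q) * Complex.I_mul_I
    simp only [hmul, hpt, integral_neg] at hinv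
    rw [hb] at hinv
    simp [one_apply, hpq] at hinv
    linear_combination -hinv / 2
  refine ⟨β, c, by simpa using h1, by simpa using h2, fun ρ => ?_⟩
  have h3' := h3 ρ
  rw [zero_mul, add_zero] at h3'
  rw [← h3']
  congr 1
  ext U
  rw [Matrix.mul_assoc, Matrix.mul_assoc, trace_mul_comm, Matrix.mul_assoc]

/-- the unitary second moment decomposes into the real and imaginary
orthogonal second moments on a single qudit. -/
theorem stmt_6 (d : ℕ) (hd : 2 ≤ d)
    [MeasurableSpace (Matrix.orthogonalGroup (Fin d) ℝ)]
    [BorelSpace (Matrix.orthogonalGroup (Fin d) ℝ)]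
    (μO : Measure (Matrix.orthogonalGroup (Fin d) ℝ))
    [μO.IsHaarMeasure] [IsProbabilityMeasure μO]
    [MeasurableSpace (Matrix.unitaryGroup (Fin d) ℂ)]
    [BorelSpace (Matrix.unitaryGroup (Fin d) ℂ)]
    (μU : Measure (Matrix.unitaryGroup (Fin d) ℂ))
    [μU.IsHaarMeasure] [IsProbabilityMeasure μU]
    (ρ : Matrix (Fin d) (Fin d) ℂ) (hρ : ρ.IsHermitian) (hρtr : ρ.trace = 1)
    (N : Matrix (Fin d) (Fin d) ℂ) (hN : N.IsHermitian)
    (hNtr : N.trace = 0) (hN2 : (N * N).trace = (d : ℂ))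
    (M : Matrix (Fin d) (Fin d) ℂ) (hM : M.IsHermitian) (hMreal : Mᵀ = M)
    (hMtr : M.trace = 0) (hM2 : (M * M).trace = (d : ℂ))
    (Mhat : Matrix (Fin d) (Fin d) ℂ) (hMhat : Mhat.IsHermitian) (hMimag : Mhatᵀ = -Mhat)
    (hMhat2 : (Mhat * Mhat).trace = (d : ℂ)) :
    ((d : ℂ) ^ 2 - 1) *
        ∫ U, ((U : Matrix (Fin d) (Fin d) ℂ) * ρ * (U : Matrix (Fin d) (Fin d) ℂ)ᴴ * N).trace ^ 2 ∂μU =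
      (((d : ℂ) - 1) * ((d : ℂ) + 2) / 2) *
          ∫ O, (OC O * ρ * (OC O)ᵀ * M).trace ^ 2 ∂μO +
        ((d : ℂ) * ((d : ℂ) - 1) / 2) *
          ∫ O, (OC O * ρ * (OC O)ᵀ * Mhat).trace ^ 2 ∂μO := by
  obtain ⟨βU, cU, hU1, hU2, hU⟩ := unitary_secondMoment hd μU hNtr hN2
  obtain ⟨β, b, c, hbc, h1, h2, hO⟩ := orthogonal_secondMoment hd μO hMtr hM2
    (s := 1) (by rw [hMreal, one_smul])
  have hMhattr : Mhat.trace = 0 := by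
    have h := trace_transpose Mhat
    rw [hMimag, trace_neg] at h
    linear_combination -h / 2
  obtain ⟨β', b', c', hbc', h1', h2', hO'⟩ := orthogonal_secondMoment hd μO hMhattr hMhat2
    (s := -1) (by rw [hMimag, neg_one_smul])
  rw [hU, hO, hO', hρtr]
  have hd0 : (d : ℂ) ≠ 0 := by
    norm_cast
    omega
  subst hbc hbc'
  have hcU : ((d : ℂ) ^ 2 - 1) * cU = d := by linear_combination d * hU2 - hU1
  have hβU : ((d : ℂ) ^ 2 - 1) * βU = -1 := by linear_combination d * hU1 - hU2
  have hc : ((d : ℂ) - 1) * (d + 2) * c = d := by linear_combination d * h2 - h1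
  have hβ : ((d : ℂ) - 1) * (d + 2) * β = -2 := by
    refine mul_left_cancel₀ hd0 ?_
    linear_combination ((d : ℂ) - 1) * (d + 2) * h1 - 2 * hc
  have hβ' : β' = 0 := by
    refine mul_left_cancel₀ hd0 ?_
    linear_combination h1'
  subst hβ'
  have hc' : ((d : ℂ) - 1) * c' = 1 := by linear_combination h2'
  linear_combination hβU + (ρ * ρ).trace * hcU - hβ / 2 -
    ((ρ * ρᵀ).trace + (ρ * ρ).trace) / 2 * hc -
    d / 2 * ((ρ * ρ).trace - (ρ * ρᵀ).trace) * hc'
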